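/- Let P be a simple polygon and W a witness set of P; assume Vis(u) equals the closure of its interior for every u ∈ W. Let w₁, …, w_m (m ≥ 3) be distinct elements of W such that w_i and w_{i+1} are adjacent in GCon(W) for each i (indices modulo m), i.e., they form a cycle in GCon(W). Then there exists exactly one connected component NV of NVis(W) such that NV is attached to Vis(w_i) for every i ∈ {1, …, m}. -/

import Mathlib

open Set

noncomputable section

abbrev Plane := EuclideanSpace ℝ (Fin 2)

/-- A simple polygon, given by a cyclic sequence of at least three distinct vertices
whose closed polygonal boundary curve is a Jordan polygon: two edges intersect exactly
when they are consecutive, and then only in their one shared endpoint. -/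
structure SimplePolygon where
  n : ℕ
  three_le : 3 ≤ n
  vertex : ℕ → Plane
  periodic : ∀ i, vertex (i + n) = vertex i
  inj : ∀ i < n, ∀ j < n, vertex i = vertex j → i = j
  jordan : ∀ i < n, ∀ j < n, i ≠ j →
    segment ℝ (vertex i) (vertex (i + 1)) ∩ segment ℝ (vertex j) (vertex (j + 1)) =
      if j = (i + 1) % n then {vertex (i + 1)}
      else if i = (j + 1) % n then {vertex (j + 1)}
      else ∅

namespace SimplePolygon

/-- The boundary curve of the polygon: the union of its edges. -/
def boundary (P : SimplePolygon) : Set Plane :=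
  ⋃ i ∈ Finset.range P.n, segment ℝ (P.vertex i) (P.vertex (i + 1))

/-- The polygon as a region: the boundary together with all bounded connected
components of the complement of the boundary. -/
def region (P : SimplePolygon) : Set Plane :=
  P.boundary ∪ {x | x ∉ P.boundary ∧
    Bornology.IsBounded (connectedComponentIn P.boundaryᶜ x)}

/-- Visibility region of a point `p`: all points `q` of the polygon such that the
closed segment `[p,q]` is contained in the polygon. -/
def Vis (P : SimplePolygon) (p : Plane) : Set Plane :=
  {q | q ∈ P.region ∧ segment ℝ p q ⊆ P.region}

/-- Visibility region of a set. -/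
def VisSet (P : SimplePolygon) (S : Set Plane) : Set Plane :=
  ⋃ p ∈ S, P.Vis p

/-- Two points of the polygon are visible to each other if the segment joining them
lies in the polygon. -/
def Visible (P : SimplePolygon) (p q : Plane) : Prop :=
  p ∈ P.region ∧ q ∈ P.region ∧ segment ℝ p q ⊆ P.region

/-- A witness set: a finite set of points of the polygon with pairwise disjoint
visibility regions. -/
def IsWitnessSet (P : SimplePolygon) (W : Set Plane) : Prop :=
  W.Finite ∧ W ⊆ P.region ∧
    ∀ x ∈ W, ∀ y ∈ W, x ≠ y → P.Vis x ∩ P.Vis y = ∅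

/-- The non-visible region of a witness set. -/
def NVis (P : SimplePolygon) (W : Set Plane) : Set Plane :=
  P.region \ ⋃ w ∈ W, P.Vis w

/-- `Vis p` is regular (has no arms) if it equals the closure of its interior. -/
def VisRegular (P : SimplePolygon) (p : Plane) : Prop :=
  P.Vis p = closure (interior (P.Vis p))

/-- A window of `Vis p`: a non-degenerate closed segment contained in the frontier of
`Vis p` whose intersection with the frontier of the polygon is exactly its two
endpoints, maximal with these properties. -/
def IsWindow (P : SimplePolygon) (p : Plane) (e : Set Plane) : Prop :=
  ∃ a b : Plane, a ≠ b ∧ e = segment ℝ a b ∧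
    e ⊆ frontier (P.Vis p) ∧
    e ∩ frontier P.region = {a, b} ∧
    ∀ a' b' : Plane, a' ≠ b' →
      segment ℝ a' b' ⊆ frontier (P.Vis p) →
      segment ℝ a' b' ∩ frontier P.region = {a', b'} →
      e ⊆ segment ℝ a' b' → e = segment ℝ a' b'

/-- `γ` is (the image of) a neighbor witness path between `w` and `w'`. -/
def IsNWPath (P : SimplePolygon) (W : Set Plane) (w w' : Plane) (γ : Set Plane) : Prop :=
  ∃ f : Path w w', γ = Set.range f ∧ γ ⊆ P.Vis w ∪ P.NVis W ∪ P.Vis w'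

/-- Adjacency in the neighbor witness graph `GCon(W)`. -/
def GConAdj (P : SimplePolygon) (W : Set Plane) (w w' : Plane) : Prop :=
  w ∈ W ∧ w' ∈ W ∧ w ≠ w' ∧ ∃ γ : Set Plane, P.IsNWPath W w w' γ

/-- A connected component `NV` of `NVis W` is attached to `Vis w` if the closure of
`NV` intersects `Vis w`. -/
def Attached (P : SimplePolygon) (NV : Set Plane) (w : Plane) : Prop :=
  (closure NV ∩ P.Vis w).Nonempty

/-- `w` is a simplicial vertex of `GCon(W)`: its neighbors are pairwise adjacent. -/
def Simplicial (P : SimplePolygon) (W : Set Plane) (w : Plane) : Prop :=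
  ∀ u v : Plane, P.GConAdj W w u → P.GConAdj W w v → u ≠ v → P.GConAdj W u v

end SimplePolygon

/-- `NV` is a connected component of `S`. -/
def IsCompOf (NV S : Set Plane) : Prop :=
  ∃ x ∈ S, NV = connectedComponentIn S x

/-- `f` admits a continuous logarithm on `S`. -/
def HasLogOn {X : Type*} [TopologicalSpace X] (f : X → ℂ) (S : Set X) : Prop :=
  ∃ l : X → ℂ, ContinuousOn l S ∧ ∀ z ∈ S, Complex.exp (l z) = f z

lemma HasLogOn.mono {X : Type*} [TopologicalSpace X] {f : X → ℂ} {S T : Set X}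
    (h : HasLogOn f T) (hST : S ⊆ T) : HasLogOn f S := by
  obtain ⟨l, hl, hf⟩ := h
  exact ⟨l, hl.mono hST, fun z hz => hf z (hST hz)⟩

/-- Every translate `z - a` with `a ∉ K` has a continuous logarithm on `K`. -/
def LogSet (K : Set ℂ) : Prop :=
  ∀ a ∉ K, HasLogOn (fun z => z - a) K

lemma LogSet.inter_re_le {K : Set ℂ} (hK : LogSet K) {ω : ℂ} (hω : ω ≠ 0) (t : ℝ) :
    LogSet (K ∩ {z | (ω * z).re ≤ t}) := by
  intro a ha
  by_cases haK : a ∈ K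
  · have hat : t < (ω * a).re := by
      by_contra h
      exact ha ⟨haK, not_lt.1 h⟩
    have hpos : ∀ z ∈ K ∩ {z | (ω * z).re ≤ t}, 0 < (-(ω * (z - a))).re := by
      rintro z ⟨-, hz⟩
      simp only [mem_ofPred_eq] at hz
      rw [mul_sub, Complex.neg_re, Complex.sub_re]
      linarith
    refine ⟨fun z => Complex.log (-(ω * (z - a))) - Complex.log (-ω), ?_, ?_⟩
    · refine ContinuousOn.sub (ContinuousOn.clog (by fun_prop) ?_) continuousOn_const
      intro z hz
      exact Complex.mem_slitPlane_iff.2 (Or.inl (hpos z hz))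
    · intro z hz
      have hne : -(ω * (z - a)) ≠ 0 := by
        intro h
        have := hpos z hz
        rw [h] at this
        simp at this
      rw [Complex.exp_sub, Complex.exp_log hne, Complex.exp_log (neg_ne_zero.2 hω)]
      field_simp
  · exact (hK a haK).mono inter_subset_left

lemma LogSet.inter_le_re {K : Set ℂ} (hK : LogSet K) {ω : ℂ} (hω : ω ≠ 0) (t : ℝ) :
    LogSet (K ∩ {z | t ≤ (ω * z).re}) := by
  have h := hK.inter_re_le (neg_ne_zero.2 hω) (-t)
  have he : {z : ℂ | (-ω * z).re ≤ -t} = {z | t ≤ (ω * z).re} := by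
    ext z
    simp only [mem_ofPred_eq, neg_mul, Complex.neg_re, neg_le_neg_iff]
  rwa [he] at h

lemma isClosed_re_le (ω : ℂ) (t : ℝ) : IsClosed {z : ℂ | (ω * z).re ≤ t} :=
  isClosed_le (by fun_prop) continuous_const

lemma isClosed_le_re (ω : ℂ) (t : ℝ) : IsClosed {z : ℂ | t ≤ (ω * z).re} :=
  isClosed_le continuous_const (by fun_prop)

lemma LogSet.exists_jump {K : Set ℂ} (hK : LogSet K) {ω a : ℂ} (hω : ω ≠ 0) (ha : a ∉ K) :
    ∃ M₁ M₂ : ℂ → ℂ, ContinuousOn M₁ (K ∩ {z | (ω * z).re ≤ (ω * a).re}) ∧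
      ContinuousOn M₂ (K ∩ {z | (ω * a).re ≤ (ω * z).re}) ∧
      (∀ z ∈ K ∩ {z | (ω * z).re ≤ (ω * a).re}, Complex.exp (M₁ z) = 1) ∧
      (∀ z ∈ K ∩ {z | (ω * a).re ≤ (ω * z).re}, Complex.exp (M₂ z) = 1) ∧
      ∀ z ∈ K, (ω * z).re = (ω * a).re →
        M₁ z - M₂ z = if (ω * a).im < (ω * z).im then 2 * Real.pi * Complex.I else 0 := by
  obtain ⟨l, hl, hle⟩ := hK a ha
  have hne : ∀ z ∈ K, ω * (z - a) ≠ 0 := by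
    intro z hz h
    rcases mul_eq_zero.1 h with h | h
    · exact hω h
    · exact ha (sub_eq_zero.1 h ▸ hz)
  have him : ∀ z ∈ K, (ω * z).re = (ω * a).re → (ω * (z - a)).im ≠ 0 := by
    intro z hz hre h
    apply hne z hz
    apply Complex.ext
    · rw [mul_sub, Complex.sub_re, hre]; simp
    · rw [h]; simp
  refine ⟨fun z => l z - (Complex.log (-(ω * (z - a))) - Complex.log ω - Real.pi * Complex.I),
    fun z => l z - (Complex.log (ω * (z - a)) - Complex.log ω), ?_, ?_, ?_, ?_, ?_⟩
  · refine (hl.mono inter_subset_left).sub (ContinuousOn.sub (ContinuousOn.sub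
      (ContinuousOn.clog (by fun_prop) ?_) continuousOn_const) continuousOn_const)
    rintro z ⟨hz, hzt⟩
    simp only [mem_ofPred_eq] at hzt
    rw [Complex.mem_slitPlane_iff]
    rcases hzt.lt_or_eq with h | h
    · left
      rw [Complex.neg_re, mul_sub, Complex.sub_re]
      linarith
    · right
      rw [Complex.neg_im]
      exact neg_ne_zero.2 (him z hz h)
  · refine (hl.mono inter_subset_left).sub (ContinuousOn.sub
      (ContinuousOn.clog (by fun_prop) ?_) continuousOn_const)
    rintro z ⟨hz, hzt⟩
    simp only [mem_ofPred_eq] at hzt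
    rw [Complex.mem_slitPlane_iff]
    rcases hzt.lt_or_eq with h | h
    · left
      rw [mul_sub, Complex.sub_re]
      linarith
    · right
      exact him z hz h.symm
  · rintro z ⟨hz, -⟩
    have h1 := hne z hz
    have h2 : z - a ≠ 0 := (mul_ne_zero_iff.1 h1).2
    rw [Complex.exp_sub, Complex.exp_sub, Complex.exp_sub, hle z hz,
      Complex.exp_log (neg_ne_zero.2 h1), Complex.exp_log hω, Complex.exp_pi_mul_I]
    field_simp
  · rintro z ⟨hz, -⟩
    have h1 := hne z hz
    have h2 : z - a ≠ 0 := (mul_ne_zero_iff.1 h1).2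
    rw [Complex.exp_sub, Complex.exp_sub, hle z hz, Complex.exp_log h1, Complex.exp_log hω]
    field_simp
  · intro z hz hre
    have hs : ω * (z - a) = (((ω * z).im - (ω * a).im : ℝ) : ℂ) * Complex.I := by
      apply Complex.ext
      · rw [mul_sub, Complex.sub_re, hre]; simp
      · rw [mul_sub, Complex.sub_im]; simp
    have hs0 : (ω * z).im - (ω * a).im ≠ 0 := by
      have := him z hz hre
      rwa [mul_sub, Complex.sub_im] at this
    simp only
    rw [hs]
    split_ifs with h
    · have hp : 0 < (ω * z).im - (ω * a).im := by linarith
      rw [← mul_neg, Complex.log_ofReal_mul hp Complex.I_ne_zero,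
        Complex.log_ofReal_mul hp (neg_ne_zero.2 Complex.I_ne_zero), Complex.log_I,
        Complex.log_neg_I]
      ring
    · have hp : 0 < -((ω * z).im - (ω * a).im) := by
        have : (ω * z).im - (ω * a).im < 0 := lt_of_le_of_ne (by linarith) hs0
        linarith
      have h3 : -((((ω * z).im - (ω * a).im : ℝ) : ℂ) * Complex.I)
          = ((-((ω * z).im - (ω * a).im) : ℝ) : ℂ) * Complex.I := by push_cast; ring
      have h4 : ((((ω * z).im - (ω * a).im : ℝ) : ℂ) * Complex.I)
          = ((-((ω * z).im - (ω * a).im) : ℝ) : ℂ) * (-Complex.I) := by push_cast; ring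
      rw [h3, Complex.log_ofReal_mul hp Complex.I_ne_zero, h4,
        Complex.log_ofReal_mul hp (neg_ne_zero.2 Complex.I_ne_zero), Complex.log_I,
        Complex.log_neg_I]
      ring

lemma HasLogOn.glue {K : Set ℂ} (hK : IsClosed K) {f : ℂ → ℂ} {ω : ℂ} {t : ℝ} {l₁ l₂ : ℂ → ℂ}
    (c₁ : ContinuousOn l₁ (K ∩ {z | (ω * z).re ≤ t}))
    (c₂ : ContinuousOn l₂ (K ∩ {z | t ≤ (ω * z).re}))
    (e₁ : ∀ z ∈ K ∩ {z | (ω * z).re ≤ t}, Complex.exp (l₁ z) = f z)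
    (e₂ : ∀ z ∈ K ∩ {z | t ≤ (ω * z).re}, Complex.exp (l₂ z) = f z)
    (hag : ∀ z ∈ K, (ω * z).re = t → l₁ z = l₂ z) : HasLogOn f K := by
  classical
  have hU : K = (K ∩ {z | (ω * z).re ≤ t}) ∪ (K ∩ {z | t ≤ (ω * z).re}) := by
    rw [← inter_union_distrib_left]
    ext z
    exact ⟨fun hz => ⟨hz, le_total (ω * z).re t⟩, fun h => h.1⟩
  have h1 : ∀ z ∈ K ∩ {z | (ω * z).re ≤ t},
      (if (ω * z).re ≤ t then l₁ z else l₂ z) = l₁ z := fun z hz => if_pos hz.2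
  have h2 : ∀ z ∈ K ∩ {z | t ≤ (ω * z).re},
      (if (ω * z).re ≤ t then l₁ z else l₂ z) = l₂ z := by
    intro z hz
    split_ifs with h
    · exact hag z hz.1 (le_antisymm h hz.2)
    · rfl
  refine ⟨fun z => if (ω * z).re ≤ t then l₁ z else l₂ z, ?_, ?_⟩
  · rw [hU]
    exact (c₁.congr h1).union_of_isClosed (c₂.congr h2)
      (hK.inter (isClosed_re_le ω t)) (hK.inter (isClosed_le_re ω t))
  · intro z hz
    rw [hU] at hz
    rcases hz with hz | hz
    · simp only
      rw [h1 z hz, e₁ z hz]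
    · simp only
      rw [h2 z hz, e₂ z hz]

/-- Integer-period jumps along a cutting line can be removed one interval at a time. -/
lemma LogSet.hasLogOn_of_jumps {K : Set ℂ} (hKc : IsClosed K) (hK : LogSet K) {f : ℂ → ℂ}
    {ω : ℂ} (hω : ω ≠ 0) {t δ : ℝ} (hδ : 0 < δ) (n : ℕ) :
    ∀ (τ : ℝ) (l₁ l₂ : ℂ → ℂ),
      ContinuousOn l₁ (K ∩ {z | (ω * z).re ≤ t}) →
      ContinuousOn l₂ (K ∩ {z | t ≤ (ω * z).re}) →
      (∀ z ∈ K ∩ {z | (ω * z).re ≤ t}, Complex.exp (l₁ z) = f z) →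
      (∀ z ∈ K ∩ {z | t ≤ (ω * z).re}, Complex.exp (l₂ z) = f z) →
      (∀ z ∈ K, (ω * z).re = t → (ω * z).im ≤ τ → l₁ z = l₂ z) →
      (∀ z ∈ K, ∀ y ∈ K, (ω * z).re = t → (ω * y).re = t → τ ≤ (ω * z).im → τ ≤ (ω * y).im →
        |(ω * z).im - (ω * y).im| ≤ δ → l₁ z - l₂ z = l₁ y - l₂ y) →
      (∀ z ∈ K, (ω * z).re = t → (ω * z).im ≤ τ + n * δ) → HasLogOn f K := by
  induction n with
  | zero =>
    intro τ l₁ l₂ c₁ c₂ e₁ e₂ hag _ hlast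
    exact HasLogOn.glue hKc c₁ c₂ e₁ e₂ fun z hz hzt =>
      hag z hz hzt (by simpa using hlast z hz hzt)
  | succ n ih =>
    intro τ l₁ l₂ c₁ c₂ e₁ e₂ hag hosc hlast
    have hlast' : ∀ z ∈ K, (ω * z).re = t → (ω * z).im ≤ τ + δ + n * δ := by
      intro z hz hzt
      have := hlast z hz hzt
      push_cast at this
      linarith
    by_cases hgap : ∀ z ∈ K, (ω * z).re = t → τ < (ω * z).im → (ω * z).im ≤ τ + δ → l₁ z = l₂ z
    · refine ih (τ + δ) l₁ l₂ c₁ c₂ e₁ e₂ ?_ ?_ hlast'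
      · intro z hz hzt hzτ
        rcases le_or_gt (ω * z).im τ with h | h
        · exact hag z hz hzt h
        · exact hgap z hz hzt h hzτ
      · intro z hz y hy hzt hyt h1 h2 h3
        exact hosc z hz y hy hzt hyt (by linarith) (by linarith) h3
    · push Not at hgap
      obtain ⟨z₀, hz₀, hz₀t, hz₀τ, hz₀δ, hne⟩ := hgap
      set a : ℂ := (⟨t, τ⟩ : ℂ) / ω with ha_def
      have hωa : ω * a = ⟨t, τ⟩ := by rw [ha_def]; field_simp
      have hre : (ω * a).re = t := by rw [hωa]
      have him : (ω * a).im = τ := by rw [hωa]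
      have ha : a ∉ K := by
        intro haK
        have h := hosc z₀ hz₀ a haK hz₀t hre hz₀τ.le him.ge
          (by rw [him, abs_of_nonneg (by linarith)]; linarith)
        rw [hag a haK hre him.le, sub_self] at h
        exact hne (sub_eq_zero.1 h)
      obtain ⟨M₁, M₂, cM₁, cM₂, eM₁, eM₂, hM⟩ := hK.exists_jump hω ha
      rw [hre] at cM₁ cM₂ eM₁ eM₂ hM
      rw [him] at hM
      have hk : Complex.exp (l₁ z₀ - l₂ z₀) = 1 := by
        have h1 := e₁ z₀ ⟨hz₀, hz₀t.le⟩
        have h2 := e₂ z₀ ⟨hz₀, hz₀t.ge⟩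
        rw [Complex.exp_sub, h1, h2, div_self]
        rw [← h1]
        exact Complex.exp_ne_zero _
      obtain ⟨k, hk⟩ := Complex.exp_eq_one_iff.1 hk
      have hd : ∀ z ∈ K, (ω * z).re = t → (l₁ z - k * M₁ z) - (l₂ z - k * M₂ z) =
          (l₁ z - l₂ z) - if τ < (ω * z).im then l₁ z₀ - l₂ z₀ else 0 := by
        intro z hz hzt
        have h := hM z hz hzt
        have h' : (l₁ z - k * M₁ z) - (l₂ z - k * M₂ z) =
          (l₁ z - l₂ z) - k * (M₁ z - M₂ z) := by ring
        rw [h', h, hk]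
        split_ifs <;> ring
      refine ih (τ + δ) (fun z => l₁ z - k * M₁ z) (fun z => l₂ z - k * M₂ z)
        (c₁.sub (continuousOn_const.mul cM₁)) (c₂.sub (continuousOn_const.mul cM₂)) ?_ ?_ ?_ ?_
        hlast'
      · intro z hz
        rw [Complex.exp_sub, Complex.exp_int_mul, eM₁ z hz, one_zpow, div_one, e₁ z hz]
      · intro z hz
        rw [Complex.exp_sub, Complex.exp_int_mul, eM₂ z hz, one_zpow, div_one, e₂ z hz]
      · intro z hz hzt hzτ
        rw [← sub_eq_zero, hd z hz hzt]
        split_ifs with h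
        · rw [hosc z hz z₀ hz₀ hzt hz₀t h.le hz₀τ.le
            (abs_le.2 ⟨by linarith, by linarith⟩), sub_self]
        · rw [hag z hz hzt (not_lt.1 h)]; simp
      · intro z hz y hy hzt hyt h1 h2 h3
        rw [hd z hz hzt, hd y hy hyt, if_pos (by linarith), if_pos (by linarith),
          hosc z hz y hy hzt hyt (by linarith) (by linarith) h3]

lemma eq_of_exp_eq_one_of_norm_lt {u v : ℂ} (hu : Complex.exp u = 1) (hv : Complex.exp v = 1)
    (h : ‖u - v‖ < 1) : u = v := by
  have he : Complex.exp (u - v) = 1 := by rw [Complex.exp_sub, hu, hv, div_one]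
  obtain ⟨n, hn⟩ := Complex.exp_eq_one_iff.1 he
  have hn0 : n = 0 := by
    by_contra hne
    have h1 : (1 : ℝ) ≤ |(n : ℝ)| := by exact_mod_cast Int.one_le_abs hne
    have h2 : ‖u - v‖ = |(n : ℝ)| * (2 * Real.pi) := by
      rw [hn]
      simp [abs_of_pos Real.pi_pos]
    have := Real.pi_gt_three
    nlinarith
  rw [hn0] at hn
  simpa [sub_eq_zero] using hn

/-- Continuous logarithms on the two sides of a line give one on the whole set. -/
lemma LogSet.hasLogOn_of_cut {K : Set ℂ} (hKc : IsCompact K) (hK : LogSet K) {f : ℂ → ℂ}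
    {ω : ℂ} (hω : ω ≠ 0) {t : ℝ} (h₁ : HasLogOn f (K ∩ {z | (ω * z).re ≤ t}))
    (h₂ : HasLogOn f (K ∩ {z | t ≤ (ω * z).re})) : HasLogOn f K := by
  obtain ⟨l₁, c₁, e₁⟩ := h₁
  obtain ⟨l₂, c₂, e₂⟩ := h₂
  set C : Set ℂ := K ∩ ({z | (ω * z).re ≤ t} ∩ {z | t ≤ (ω * z).re}) with hC
  have hCc : IsCompact C := hKc.inter_right ((isClosed_re_le ω t).inter (isClosed_le_re ω t))
  have hmem : ∀ z ∈ K, (ω * z).re = t → z ∈ C := fun z hz hzt => ⟨hz, hzt.le, hzt.ge⟩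
  have hd : ContinuousOn (fun z => l₁ z - l₂ z) C :=
    (c₁.mono fun z hz => ⟨hz.1, hz.2.1⟩).sub (c₂.mono fun z hz => ⟨hz.1, hz.2.2⟩)
  have hexp : ∀ z ∈ C, Complex.exp (l₁ z - l₂ z) = 1 := by
    intro z hz
    rw [Complex.exp_sub, e₁ z ⟨hz.1, hz.2.1⟩, ← e₂ z ⟨hz.1, hz.2.2⟩,
      div_self (Complex.exp_ne_zero _)]
  obtain ⟨ε, hε, hunif⟩ := Metric.uniformContinuousOn_iff.1
    (hCc.uniformContinuousOn_of_continuous hd) 1 one_pos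
  have hωp : 0 < ‖ω‖ := norm_pos_iff.2 hω
  obtain ⟨R, hR⟩ := hKc.isBounded.exists_norm_le
  have him : ∀ z ∈ K, |(ω * z).im| ≤ ‖ω‖ * R := by
    intro z hz
    refine (Complex.abs_im_le_norm _).trans ?_
    rw [norm_mul]
    exact mul_le_mul_of_nonneg_left (hR z hz) hωp.le
  set δ := ‖ω‖ * ε / 2 with hδ_def
  have hδ : 0 < δ := by positivity
  obtain ⟨n, hn⟩ := exists_nat_ge ((2 * (‖ω‖ * R) + 1) / δ)
  rw [div_le_iff₀ hδ] at hn
  refine hK.hasLogOn_of_jumps hKc.isClosed hω hδ n (-(‖ω‖ * R) - 1) l₁ l₂ c₁ c₂ e₁ e₂ ?_ ?_ ?_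
  · intro z hz _ h
    have := neg_le_of_abs_le (him z hz)
    linarith
  · intro z hz y hy hzt hyt _ _ h
    apply eq_of_exp_eq_one_of_norm_lt (hexp z (hmem z hz hzt)) (hexp y (hmem y hy hyt))
    rw [← dist_eq_norm]
    apply hunif z (hmem z hz hzt) y (hmem y hy hyt)
    have h1 : ‖ω‖ * dist z y = |(ω * z).im - (ω * y).im| := by
      rw [dist_eq_norm, ← norm_mul]
      have : ω * (z - y) = (((ω * z).im - (ω * y).im : ℝ) : ℂ) * Complex.I := by
        apply Complex.ext
        · rw [mul_sub, Complex.sub_re, hzt, hyt]; simp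
        · rw [mul_sub, Complex.sub_im]; simp
      rw [this, norm_mul, Complex.norm_I, mul_one, Complex.norm_real, Real.norm_eq_abs]
    have h2 : ‖ω‖ * dist z y < ‖ω‖ * ε := by rw [h1]; linarith
    exact lt_of_mul_lt_mul_left h2 hωp.le
  · intro z hz _
    have := le_of_abs_le (him z hz)
    linarith

/-- Continuous logarithms on all parallel strips of a fixed width give one on the whole set. -/
lemma LogSet.hasLogOn_of_strips {K : Set ℂ} (hKc : IsCompact K) (hK : LogSet K) {f : ℂ → ℂ}
    {ω : ℂ} (hω : ω ≠ 0) {δ : ℝ} (hδ : 0 < δ)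
    (h : ∀ s : ℝ, HasLogOn f (K ∩ {z | s ≤ (ω * z).re} ∩ {z | (ω * z).re ≤ s + δ})) :
    HasLogOn f K := by
  obtain ⟨R, hR⟩ := hKc.isBounded.exists_norm_le
  have hre : ∀ z ∈ K, |(ω * z).re| ≤ ‖ω‖ * R := by
    intro z hz
    refine (Complex.abs_re_le_norm _).trans ?_
    rw [norm_mul]
    exact mul_le_mul_of_nonneg_left (hR z hz) (norm_nonneg _)
  set s := -(‖ω‖ * R) with hs
  have key : ∀ n : ℕ,
      HasLogOn f (K ∩ {z | s ≤ (ω * z).re} ∩ {z | (ω * z).re ≤ s + n * δ}) := by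
    intro n
    induction n with
    | zero =>
      refine (h s).mono ?_
      rintro z ⟨hz, hz'⟩
      refine ⟨hz, ?_⟩
      simp only [mem_ofPred_eq, Nat.cast_zero] at hz' ⊢
      linarith
    | succ n ih =>
      refine LogSet.hasLogOn_of_cut (ω := ω) (t := s + n * δ) ?_ ?_ hω ?_ ?_
      · exact (hKc.inter_right (isClosed_le_re ω _)).inter_right (isClosed_re_le ω _)
      · exact (hK.inter_le_re hω _).inter_re_le hω _
      · exact ih.mono fun z hz => ⟨hz.1.1, hz.2⟩
      · refine (h (s + n * δ)).mono ?_
        rintro z ⟨⟨⟨hz, _⟩, hz'⟩, hz''⟩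
        refine ⟨⟨hz, hz''⟩, ?_⟩
        simp only [mem_ofPred_eq, Nat.cast_succ] at hz' ⊢
        linarith
  obtain ⟨n, hn⟩ := exists_nat_ge ((2 * (‖ω‖ * R)) / δ)
  rw [div_le_iff₀ hδ] at hn
  refine (key n).mono fun z hz => ⟨⟨hz, ?_⟩, ?_⟩
  · exact neg_le_of_abs_le (hre z hz)
  · have := le_of_abs_le (hre z hz)
    simp only [mem_ofPred_eq]
    linarith

lemma hasLogOn_of_norm_sub_lt {X : Type*} [TopologicalSpace X] {f : X → ℂ} {S : Set X}
    (hf : ContinuousOn f S) {c : ℂ} (hc : c ≠ 0) (h : ∀ z ∈ S, ‖f z - c‖ < ‖c‖) :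
    HasLogOn f S := by
  have hslit : ∀ z ∈ S, f z / c ∈ Complex.slitPlane := by
    intro z hz
    have h1 : f z / c = 1 + (f z - c) / c := by field_simp; ring
    rw [h1]
    apply Complex.mem_slitPlane_of_norm_lt_one
    rw [norm_div, div_lt_one (norm_pos_iff.2 hc)]
    exact h z hz
  refine ⟨fun z => Complex.log (f z / c) + Complex.log c, ?_, ?_⟩
  · exact (ContinuousOn.clog (hf.div_const c) hslit).add continuousOn_const
  · intro z hz
    rw [Complex.exp_add, Complex.exp_log (Complex.slitPlane_ne_zero (hslit z hz)),
      Complex.exp_log hc]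
    field_simp

/-- Borsuk: if all `z - a` with `a ∉ K` have continuous logarithms on the compact set `K`,
then so does every nowhere vanishing continuous function. -/
theorem LogSet.hasLogOn {K : Set ℂ} (hKc : IsCompact K) (hK : LogSet K) {f : ℂ → ℂ}
    (hf : ContinuousOn f K) (hf0 : ∀ z ∈ K, f z ≠ 0) : HasLogOn f K := by
  rcases K.eq_empty_or_nonempty with rfl | hne
  · exact ⟨0, continuousOn_empty _, by simp⟩
  obtain ⟨z₁, hz₁, hmin⟩ := hKc.exists_isMinOn hne hf.norm
  have hm : 0 < ‖f z₁‖ := norm_pos_iff.2 (hf0 z₁ hz₁)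
  obtain ⟨ε, hε, hunif⟩ := Metric.uniformContinuousOn_iff.1
    (hKc.uniformContinuousOn_of_continuous hf) _ hm
  have hI : (-Complex.I : ℂ) ≠ 0 := neg_ne_zero.2 Complex.I_ne_zero
  have hδ : 0 < ε / 3 := by positivity
  refine hK.hasLogOn_of_strips hKc one_ne_zero hδ fun s => ?_
  refine LogSet.hasLogOn_of_strips
    ((hKc.inter_right (isClosed_le_re _ _)).inter_right (isClosed_re_le _ _))
    ((hK.inter_le_re one_ne_zero _).inter_re_le one_ne_zero _) hI hδ fun r => ?_
  set S := K ∩ {z | s ≤ (1 * z : ℂ).re} ∩ {z | (1 * z : ℂ).re ≤ s + ε / 3} ∩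
    {z | r ≤ (-Complex.I * z).re} ∩ {z | (-Complex.I * z).re ≤ r + ε / 3} with hS
  have hSK : S ⊆ K := fun z hz => hz.1.1.1.1
  rcases S.eq_empty_or_nonempty with he | ⟨z₀, hz₀⟩
  · rw [he]
    exact ⟨0, continuousOn_empty _, by simp⟩
  refine hasLogOn_of_norm_sub_lt (hf.mono hSK) (hf0 z₀ (hSK hz₀)) fun z hz => ?_
  refine lt_of_lt_of_le ?_ (hmin (hSK hz₀))
  rw [← dist_eq_norm]
  apply hunif z (hSK hz) z₀ (hSK hz₀)
  obtain ⟨⟨⟨⟨_, a1⟩, a2⟩, a3⟩, a4⟩ := hz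
  obtain ⟨⟨⟨⟨_, b1⟩, b2⟩, b3⟩, b4⟩ := hz₀
  simp only [mem_ofPred_eq, one_mul, neg_mul, Complex.neg_re, Complex.mul_re, Complex.I_re,
    Complex.I_im, zero_mul, zero_sub, neg_neg] at a1 a2 a3 a4 b1 b2 b3 b4
  rw [dist_eq_norm]
  refine (Complex.norm_le_abs_re_add_abs_im _).trans_lt ?_
  have h1 : |(z - z₀).re| ≤ ε / 3 := by
    rw [Complex.sub_re]; exact abs_le.2 ⟨by linarith, by linarith⟩
  have h2 : |(z - z₀).im| ≤ ε / 3 := by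
    rw [Complex.sub_im]; exact abs_le.2 ⟨by linarith, by linarith⟩
  linarith

/-- A compact set avoided by an unbounded preconnected set `O` admits logarithms of `z - a` for
`a ∈ O`. -/
lemma hasLogOn_sub_of_unbounded {K O : Set ℂ} (hK : IsCompact K) (hO : IsPreconnected O)
    (hOu : ¬ Bornology.IsBounded O) (hdisj : Disjoint K O) {a : ℂ} (ha : a ∈ O) :
    HasLogOn (fun z => z - a) K := by
  have step : ∀ a b : ℂ, (∀ z ∈ K, ‖b - a‖ < ‖z - a‖) → HasLogOn (fun z => z - a) K →
      HasLogOn (fun z => z - b) K := by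
    rintro a b hab ⟨l, hl, hle⟩
    have hne : ∀ z ∈ K, z - a ≠ 0 := fun z hz =>
      norm_pos_iff.1 ((norm_nonneg _).trans_lt (hab z hz))
    have hq : HasLogOn (fun z => 1 - (b - a) / (z - a)) K := by
      refine hasLogOn_of_norm_sub_lt ?_ one_ne_zero fun z hz => ?_
      · exact continuousOn_const.sub (continuousOn_const.div (by fun_prop) hne)
      · have h1 : 1 - (b - a) / (z - a) - 1 = -((b - a) / (z - a)) := by ring
        rw [h1, norm_neg, norm_div, norm_one, div_lt_one (norm_pos_iff.2 (hne z hz))]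
        exact hab z hz
    obtain ⟨l', hl', hle'⟩ := hq
    refine ⟨fun z => l z + l' z, hl.add hl', fun z hz => ?_⟩
    rw [Complex.exp_add, hle z hz, hle' z hz]
    have := hne z hz
    field_simp
    ring
  obtain ⟨R, hR⟩ := hK.isBounded.exists_norm_le
  obtain ⟨b, hb, hbR⟩ : ∃ b ∈ O, max R 0 < ‖b‖ := by
    by_contra h
    push Not at h
    exact hOu (isBounded_iff_forall_norm_le.2 ⟨_, h⟩)
  have hbl : HasLogOn (fun z => z - b) K := by
    have hb0 : 0 < ‖b‖ := (le_max_right _ _).trans_lt hbR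
    refine hasLogOn_of_norm_sub_lt (c := -b) (by fun_prop) (neg_ne_zero.2 (norm_pos_iff.1 hb0))
      fun z hz => ?_
    have : z - b - -b = z := by ring
    rw [this, norm_neg]
    exact ((hR z hz).trans (le_max_left _ _)).trans_lt hbR
  refine (hO.induction₂ (fun x y => HasLogOn (fun z => z - x) K ↔ HasLogOn (fun z => z - y) K)
    ?_ (fun x y z _ _ _ h h' => h.trans h') (fun x y _ _ h => h.symm) hb ha).1 hbl
  intro x hx
  have hxK : x ∈ Kᶜ := fun h => hdisj.le_bot ⟨h, hx⟩
  obtain ⟨r, hr, hball⟩ := Metric.isOpen_iff.1 hK.isClosed.isOpen_compl x hxK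
  have hfar : ∀ z ∈ K, r ≤ ‖z - x‖ := by
    intro z hz
    by_contra h
    push Not at h
    exact hball (by rwa [Metric.mem_ball, dist_eq_norm]) hz
  filter_upwards [mem_nhdsWithin_of_mem_nhds (Metric.ball_mem_nhds x (half_pos hr))] with y hy
  rw [Metric.mem_ball, dist_eq_norm] at hy
  refine ⟨step x y fun z hz => ?_, step y x fun z hz => ?_⟩
  · have := hfar z hz
    linarith
  · have h1 := hfar z hz
    have h2 : ‖z - x‖ ≤ ‖z - y‖ + ‖y - x‖ := by
      have : z - x = (z - y) + (y - x) := by ring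
      rw [this]
      exact norm_add_le _ _
    rw [norm_sub_rev x y]
    linarith

/-- `x` and `y` lie in a common preconnected subset of `S`. -/
def Linked {X : Type*} [TopologicalSpace X] (S : Set X) (x y : X) : Prop :=
  ∃ T ⊆ S, IsPreconnected T ∧ x ∈ T ∧ y ∈ T

lemma Linked.mono {X : Type*} [TopologicalSpace X] {S T : Set X} {x y : X} (h : Linked S x y)
    (hST : S ⊆ T) : Linked T x y := by
  obtain ⟨U, hU, hc, hx, hy⟩ := h
  exact ⟨U, hU.trans hST, hc, hx, hy⟩

lemma Linked.symm {X : Type*} [TopologicalSpace X] {S : Set X} {x y : X} (h : Linked S x y) :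
    Linked S y x := by
  obtain ⟨U, hU, hc, hx, hy⟩ := h
  exact ⟨U, hU, hc, hy, hx⟩

lemma Linked.trans {X : Type*} [TopologicalSpace X] {S : Set X} {x y z : X} (h : Linked S x y)
    (h' : Linked S y z) : Linked S x z := by
  obtain ⟨U, hU, hc, hx, hy⟩ := h
  obtain ⟨V, hV, hc', hy', hz⟩ := h'
  exact ⟨U ∪ V, union_subset hU hV, hc.union y hy hy' hc', Or.inl hx, Or.inr hz⟩

lemma IsPreconnected.eq_of_exp_eq_one {X : Type*} [TopologicalSpace X] {T : Set X}
    (hT : IsPreconnected T) {c : X → ℂ} (hc : ContinuousOn c T)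
    (he : ∀ z ∈ T, Complex.exp (c z) = 1) {x y : X} (hx : x ∈ T) (hy : y ∈ T) : c x = c y := by
  refine hT.induction₂ (fun x y => c x = c y) ?_ (fun x y z _ _ _ h h' => h.trans h')
    (fun x y _ _ h => h.symm) hx hy
  intro z hz
  have h := (hc z hz).eventually (Metric.ball_mem_nhds (c z) one_pos)
  filter_upwards [h, self_mem_nhdsWithin] with y hy hyT
  apply eq_of_exp_eq_one_of_norm_lt (he z hz) (he y hyT)
  have h2 : dist (c y) (c z) < 1 := hy
  rwa [dist_comm, dist_eq_norm] at h2

/-- Every point of `K` has a ball in which `K` is star-shaped about that point. -/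
def LocallyStar {E : Type*} [NormedAddCommGroup E] [NormedSpace ℝ E] (K : Set E) : Prop :=
  ∀ p ∈ K, ∃ r > 0, ∀ z ∈ K, dist z p < r → segment ℝ p z ⊆ K

lemma LocallyStar.eventually_component {E : Type*} [NormedAddCommGroup E] [NormedSpace ℝ E]
    {K C : Set E} (hK : LocallyStar K) (hC : IsClosed C) {p : E} (hp : p ∈ K \ C) (x : E) :
    ∀ᶠ z in nhdsWithin p K,
      (z ∈ connectedComponentIn (K \ C) x ↔ p ∈ connectedComponentIn (K \ C) x) := by
  obtain ⟨r, hr, hstar⟩ := hK p hp.1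
  obtain ⟨s, hs, hball⟩ := Metric.isOpen_iff.1 hC.isOpen_compl p hp.2
  filter_upwards [mem_nhdsWithin_of_mem_nhds (Metric.ball_mem_nhds p (lt_min hr hs)),
    self_mem_nhdsWithin] with z hz hzK
  rw [Metric.mem_ball, lt_min_iff] at hz
  have hsub : segment ℝ p z ⊆ K \ C := by
    intro y hy
    refine ⟨hstar z hzK hz.1 hy, ?_⟩
    exact hball ((convex_ball p s).segment_subset (Metric.mem_ball_self hs) hz.2 hy)
  have hpre : IsPreconnected (segment ℝ p z) := (convex_segment p z).isPreconnected
  constructor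
  · intro h
    rw [connectedComponentIn_eq h]
    exact hpre.subset_connectedComponentIn (right_mem_segment ℝ p z) hsub
      (left_mem_segment ℝ p z)
  · intro h
    rw [connectedComponentIn_eq h]
    exact hpre.subset_connectedComponentIn (left_mem_segment ℝ p z) hsub
      (right_mem_segment ℝ p z)

/-- Janiszewski: if neither of two disjoint closed sets separates `x` from `y` in `K`, then their
union does not either. -/
theorem LocallyStar.linked_diff_union {E : Type*} [NormedAddCommGroup E] [NormedSpace ℝ E]
    {K A B : Set E} (hK : LocallyStar K)
    (hlog : ∀ f : E → ℂ, ContinuousOn f K → (∀ z ∈ K, f z ≠ 0) → HasLogOn f K)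
    (hA : IsClosed A) (hB : IsClosed B) (hAB : Disjoint A B) {x y : E}
    (hxA : Linked (K \ A) x y) (hxB : Linked (K \ B) x y) : Linked (K \ (A ∪ B)) x y := by
  classical
  obtain ⟨T, hT, hTc, hxT, hyT⟩ := hxA
  obtain ⟨U, hU, hUc, hxU, hyU⟩ := hxB
  have hx : x ∈ K \ (A ∪ B) :=
    ⟨(hT hxT).1, fun h => h.elim (hT hxT).2 (hU hxU).2⟩
  set D := connectedComponentIn (K \ (A ∪ B)) x with hD
  have hxD : x ∈ D := mem_connectedComponentIn hx
  by_cases hyD : y ∈ D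
  · exact ⟨D, connectedComponentIn_subset _ _, isPreconnected_connectedComponentIn, hxD, hyD⟩
  exfalso
  obtain ⟨φ, hφA, hφB, -⟩ := exists_continuous_zero_one_of_isClosed hA hB hAB
  have hite : ∀ (S : Set E) (p q : E → ℂ), S ⊆ K → Continuous p → Continuous q →
      (∀ z ∈ S, z ∈ A ∪ B → p z = q z) →
      ContinuousOn (fun z => if z ∈ D then p z else q z) S := by
    intro S p q hSK hp hq hpq z hz
    by_cases hzAB : z ∈ A ∪ B
    · have hval : (if z ∈ D then p z else q z) = p z := by
        split_ifs
        · rfl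
        · exact (hpq z hz hzAB).symm
      rw [ContinuousWithinAt, hval]
      refine Filter.Tendsto.if' hp.continuousWithinAt ?_
      rw [hpq z hz hzAB]
      exact hq.continuousWithinAt
    · have hev := (hK.eventually_component (hA.union hB) ⟨hSK hz, hzAB⟩ x).filter_mono
        (nhdsWithin_mono z hSK)
      by_cases hzD : z ∈ D
      · refine hp.continuousWithinAt.congr_of_eventuallyEq ?_ (if_pos hzD)
        filter_upwards [hev] with w hw
        exact if_pos (hw.2 hzD)
      · refine hq.continuousWithinAt.congr_of_eventuallyEq ?_ (if_neg hzD)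
        filter_upwards [hev] with w hw
        exact if_neg fun h => hzD (hw.1 h)
  have hφc : Continuous fun z => 2 * Real.pi * Complex.I * (φ z : ℂ) := by fun_prop
  obtain ⟨l, hl, hle⟩ := hlog
    (fun z => if z ∈ D then Complex.exp (2 * Real.pi * Complex.I * (φ z : ℂ)) else 1)
    (hite K _ _ Subset.rfl hφc.cexp continuous_const (by
      rintro z - (h | h)
      · simp [hφA h]
      · simp [hφB h]))
    (by
      intro z _
      split_ifs
      · exact Complex.exp_ne_zero _
      · exact one_ne_zero)
  simp only at hle
  have hTK : T ⊆ K := fun z hz => (hT hz).1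
  have hUK : U ⊆ K := fun z hz => (hU hz).1
  have h1 := hTc.eq_of_exp_eq_one
    (c := fun z => l z - if z ∈ D then 2 * Real.pi * Complex.I * (φ z : ℂ)
      else 2 * Real.pi * Complex.I)
    ((hl.mono hTK).sub (hite T _ _ hTK hφc continuous_const (by
      rintro z hz (h | h)
      · exact absurd h (hT hz).2
      · simp [hφB h])))
    (by
      intro z hz
      rw [Complex.exp_sub, hle z (hTK hz)]
      split_ifs
      · exact div_self (Complex.exp_ne_zero _)
      · rw [Complex.exp_two_pi_mul_I, div_one]) hxT hyT
  have h2 := hUc.eq_of_exp_eq_one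
    (c := fun z => l z - if z ∈ D then 2 * Real.pi * Complex.I * (φ z : ℂ) else 0)
    ((hl.mono hUK).sub (hite U _ _ hUK hφc continuous_const (by
      rintro z hz (h | h)
      · simp [hφA h]
      · exact absurd h (hU hz).2)))
    (by
      intro z hz
      rw [Complex.exp_sub, hle z (hUK hz)]
      split_ifs
      · exact div_self (Complex.exp_ne_zero _)
      · rw [Complex.exp_zero, div_one]) hxU hyU
  simp only [if_pos hxD, if_neg hyD] at h1 h2
  rw [h1, sub_zero] at h2
  exact Complex.two_pi_I_ne_zero (sub_eq_self.1 h2)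

/-- Finitely many pairwise disjoint closed sets, none of which separates `x` from `y` in `K`, do
not separate them together. -/
theorem LocallyStar.linked_diff_biUnion {E ι : Type*} [NormedAddCommGroup E] [NormedSpace ℝ E]
    {K : Set E} (hK : LocallyStar K)
    (hlog : ∀ f : E → ℂ, ContinuousOn f K → (∀ z ∈ K, f z ≠ 0) → HasLogOn f K)
    {W : Set ι} (hW : W.Finite) {A : ι → Set E} (hA : ∀ u ∈ W, IsClosed (A u))
    (hdisj : ∀ u ∈ W, ∀ v ∈ W, u ≠ v → Disjoint (A u) (A v)) {x y : E} (hxy : Linked K x y)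
    (h : ∀ u ∈ W, Linked (K \ A u) x y) : Linked (K \ ⋃ u ∈ W, A u) x y := by
  induction W, hW using Set.Finite.induction_on with
  | empty => simpa using hxy
  | @insert a t hat ht ih =>
    rw [biUnion_insert]
    refine hK.linked_diff_union hlog (hA a (mem_insert a t)) ?_ ?_ (h a (mem_insert a t))
      (ih (fun u hu => hA u (mem_insert_of_mem a hu))
        (fun u hu v hv => hdisj u (mem_insert_of_mem a hu) v (mem_insert_of_mem a hv))
        (fun u hu => h u (mem_insert_of_mem a hu)))
    · exact ht.isClosed_biUnion fun u hu => hA u (mem_insert_of_mem a hu)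
    · rw [disjoint_iUnion₂_right]
      intro u hu
      exact hdisj a (mem_insert a t) u (mem_insert_of_mem a hu) fun e => hat (e ▸ hu)

lemma exists_segment_local_cone {E : Type*} [NormedAddCommGroup E] [NormedSpace ℝ E]
    (a b p : E) :
    ∃ r > 0, ∀ z, dist z p < r → ∀ y ∈ segment ℝ p z, y ≠ p → y ∈ segment ℝ a b →
      z ∈ segment ℝ a b := by
  by_cases hp : p ∈ segment ℝ a b
  · rw [segment_eq_image'] at hp
    obtain ⟨α, hα, rfl⟩ := hp
    simp only
    rcases eq_or_ne a b with rfl | hab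
    · refine ⟨1, one_pos, fun z _ y _ hne hy => ?_⟩
      rw [segment_same, mem_singleton_iff] at hy
      simp [hy] at hne
    have hb : 0 < ‖b - a‖ := norm_pos_iff.2 (sub_ne_zero.2 hab.symm)
    obtain ⟨ρ, hρ, hρ0, hρ1⟩ : ∃ ρ > 0, (α ≠ 0 → ρ ≤ α) ∧ (α ≠ 1 → ρ ≤ 1 - α) := by
      by_cases h0 : α = 0
      · exact ⟨1, one_pos, fun h => absurd h0 h, fun _ => by rw [h0]; norm_num⟩
      by_cases h1 : α = 1
      · exact ⟨1, one_pos, fun _ => h1.ge, fun h => absurd h1 h⟩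
      refine ⟨min α (1 - α), lt_min (lt_of_le_of_ne hα.1 (Ne.symm h0)) ?_,
        fun _ => min_le_left _ _, fun _ => min_le_right _ _⟩
      exact sub_pos.2 (lt_of_le_of_ne hα.2 h1)
    refine ⟨ρ * ‖b - a‖, by positivity, fun z hz y hyz hne hy => ?_⟩
    rw [segment_eq_image'] at hyz hy ⊢
    obtain ⟨s, hs, rfl⟩ := hyz
    obtain ⟨β, hβ, hβe⟩ := hy
    simp only at hβe hne
    have hs0 : 0 < s := by
      refine lt_of_le_of_ne hs.1 fun h => hne ?_
      rw [← h, zero_smul, add_zero]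
    have hdir : z - (a + α • (b - a)) = ((β - α) / s) • (b - a) := by
      have h1 : s • (z - (a + α • (b - a))) = (β - α) • (b - a) := by
        rw [sub_smul]
        have := hβe
        rw [add_assoc, add_right_inj] at this
        rw [this]
        abel
      rw [div_eq_inv_mul, mul_smul, ← h1, inv_smul_smul₀ hs0.ne']
    set γ := (β - α) / s with hγ
    have hγρ : |γ| < ρ := by
      rw [dist_eq_norm, hdir, norm_smul, Real.norm_eq_abs] at hz
      exact lt_of_mul_lt_mul_right hz hb.le
    have hγs : γ * s = β - α := by rw [hγ]; field_simp
    have habs := abs_lt.1 hγρ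
    refine ⟨α + γ, ⟨?_, ?_⟩, ?_⟩
    · by_cases h0 : α = 0
      · have : 0 ≤ γ * s := by rw [hγs, h0, sub_zero]; exact hβ.1
        have := nonneg_of_mul_nonneg_left this hs0
        linarith
      · have := hρ0 h0
        linarith
    · by_cases h1 : α = 1
      · have : 0 ≤ (-γ) * s := by rw [neg_mul, hγs, h1]; linarith [hβ.2]
        have := nonneg_of_mul_nonneg_left this hs0
        linarith
      · have := hρ1 h1
        linarith
    · simp only
      rw [add_smul, ← hdir]
      abel
  · have hcl : IsClosed (segment ℝ a b) := by
      rw [segment_eq_image']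
      exact (isCompact_Icc.image (by fun_prop)).isClosed
    obtain ⟨r, hr, hball⟩ := Metric.isOpen_iff.1 hcl.isOpen_compl p hp
    refine ⟨r, hr, fun z hz y hyz _ hy => ?_⟩
    exact absurd hy (hball ((convex_ball p r).segment_subset (Metric.mem_ball_self hr) hz hyz))

namespace SimplePolygon

lemma isCompact_boundary (P : SimplePolygon) : IsCompact P.boundary := by
  refine (Finset.range P.n).isCompact_biUnion fun i _ => ?_
  rw [segment_eq_image']
  exact isCompact_Icc.image (by fun_prop)

lemma isClosed_region (P : SimplePolygon) : IsClosed P.region := by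
  have hc : P.regionᶜ = {x | x ∈ P.boundaryᶜ ∧
      ¬ Bornology.IsBounded (connectedComponentIn P.boundaryᶜ x)} := by
    ext x
    simp only [region, mem_compl_iff, mem_union, mem_ofPred_eq]
    tauto
  rw [← isOpen_compl_iff, hc, isOpen_iff_forall_mem_open]
  rintro x ⟨hx, hxu⟩
  have ho : IsOpen P.boundaryᶜ := P.isCompact_boundary.isClosed.isOpen_compl
  refine ⟨connectedComponentIn P.boundaryᶜ x, fun y hy => ?_, ho.connectedComponentIn,
    mem_connectedComponentIn hx⟩
  refine ⟨connectedComponentIn_subset _ _ hy, ?_⟩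
  rwa [← connectedComponentIn_eq hy]

lemma isBounded_region (P : SimplePolygon) : Bornology.IsBounded P.region := by
  obtain ⟨R, hR⟩ := P.isCompact_boundary.isBounded.exists_norm_le
  refine isBounded_iff_forall_norm_le.2 ⟨max R 0, fun x hx => ?_⟩
  by_contra hxR
  push Not at hxR
  have hx0 : 0 < ‖x‖ := (le_max_right _ _).trans_lt hxR
  have hray : (fun s : ℝ => s • x) '' Ici 1 ⊆ P.boundaryᶜ := by
    rintro _ ⟨s, hs, rfl⟩ hb
    have h1 := (hR _ hb).trans (le_max_left R 0)
    rw [norm_smul, Real.norm_eq_abs, abs_of_nonneg (zero_le_one.trans hs)] at h1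
    have hs' : (1 : ℝ) ≤ s := hs
    nlinarith
  have hxr : x ∈ (fun s : ℝ => s • x) '' Ici 1 := ⟨1, self_mem_Ici, one_smul ℝ x⟩
  rcases hx with hx | ⟨hx, hb⟩
  · exact hray hxr hx
  · have hpre : IsPreconnected ((fun s : ℝ => s • x) '' Ici 1) :=
      isPreconnected_Ici.image _ (by fun_prop)
    obtain ⟨M, hM⟩ := (hb.subset (hpre.subset_connectedComponentIn hxr hray)).exists_norm_le
    have h1 := hM ((max 1 (M / ‖x‖ + 1)) • x) ⟨max 1 (M / ‖x‖ + 1), mem_Ici.2 (le_max_left _ _), rfl⟩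
    rw [norm_smul, Real.norm_eq_abs, abs_of_pos (lt_max_of_lt_left one_pos)] at h1
    have h2 : (M / ‖x‖ + 1) * ‖x‖ ≤ max 1 (M / ‖x‖ + 1) * ‖x‖ :=
      mul_le_mul_of_nonneg_right (le_max_right _ _) hx0.le
    rw [add_mul, div_mul_cancel₀ _ hx0.ne'] at h2
    linarith

lemma isCompact_region (P : SimplePolygon) : IsCompact P.region :=
  Metric.isCompact_of_isClosed_isBounded P.isClosed_region P.isBounded_region

lemma eventually_boundary_local_cone (P : SimplePolygon) (p : Plane) :
    ∀ᶠ z in nhds p, ∀ y ∈ segment ℝ p z, y ≠ p → y ∈ P.boundary → z ∈ P.boundary := by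
  have h : ∀ᶠ z in nhds p, ∀ i ∈ Finset.range P.n, ∀ y ∈ segment ℝ p z, y ≠ p →
      y ∈ segment ℝ (P.vertex i) (P.vertex (i + 1)) →
      z ∈ segment ℝ (P.vertex i) (P.vertex (i + 1)) := by
    rw [Filter.eventually_all_finset]
    intro i _
    obtain ⟨r, hr, h⟩ := exists_segment_local_cone (P.vertex i) (P.vertex (i + 1)) p
    filter_upwards [Metric.ball_mem_nhds p hr] with z hz
    exact h z hz
  filter_upwards [h] with z hz y hy hyp hyb
  simp only [boundary, mem_iUnion] at hyb ⊢
  obtain ⟨i, hi, hyi⟩ := hyb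
  exact ⟨i, hi, hz i hi y hy hyp hyi⟩

lemma eventually_segment_subset_boundary (P : SimplePolygon) (p : Plane) :
    ∀ᶠ z in nhds p, z ∈ P.boundary → segment ℝ p z ⊆ P.boundary := by
  have h : ∀ᶠ z in nhds p, ∀ i ∈ Finset.range P.n,
      z ∈ segment ℝ (P.vertex i) (P.vertex (i + 1)) →
      p ∈ segment ℝ (P.vertex i) (P.vertex (i + 1)) := by
    rw [Filter.eventually_all_finset]
    intro i _
    by_cases hp : p ∈ segment ℝ (P.vertex i) (P.vertex (i + 1))
    · exact Filter.Eventually.of_forall fun _ _ => hp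
    · have hcl : IsClosed (segment ℝ (P.vertex i) (P.vertex (i + 1))) := by
        rw [segment_eq_image']
        exact (isCompact_Icc.image (by fun_prop)).isClosed
      filter_upwards [hcl.isOpen_compl.mem_nhds hp] with z hz hz'
      exact absurd hz' hz
  filter_upwards [h] with z hz hzb y hy
  simp only [boundary, mem_iUnion] at hzb ⊢
  obtain ⟨i, hi, hzi⟩ := hzb
  exact ⟨i, hi, (convex_segment _ _).segment_subset (hz i hi hzi) hzi hy⟩

lemma locallyStar_region (P : SimplePolygon) : LocallyStar P.region := by
  intro p hp
  obtain ⟨r, hr, h⟩ := Metric.eventually_nhds_iff.1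
    ((P.eventually_boundary_local_cone p).and (P.eventually_segment_subset_boundary p))
  refine ⟨r, hr, fun z hz hzr y hy => ?_⟩
  obtain ⟨h1, h2⟩ := h hzr
  rcases hz with hz | ⟨hz, hzb⟩
  · exact Or.inl (h2 hz hy)
  rcases eq_or_ne y p with rfl | hyp
  · exact hp
  refine Or.inr ⟨fun hyb => hz (h1 y hy hyp hyb), ?_⟩
  have hsub : segment ℝ y z ⊆ P.boundaryᶜ := by
    intro w hw hwb
    have hwp : w ≠ p := by
      rintro rfl
      rw [segment_eq_image'] at hy hw
      obtain ⟨s, hs, rfl⟩ := hy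
      obtain ⟨t, ht, hte⟩ := hw
      have hzw : (s + t * (1 - s)) • (z - w) = 0 := by
        simp only at hte
        have : (s + t * (1 - s)) • (z - w)
            = w + s • (z - w) + t • (z - (w + s • (z - w))) - w := by
          module
        rw [this, hte, sub_self]
      have hs0 : s ≠ 0 := by
        rintro rfl
        simp at hyp
      have hpos : 0 < s + t * (1 - s) :=
        add_pos_of_pos_of_nonneg (lt_of_le_of_ne hs.1 hs0.symm)
          (mul_nonneg ht.1 (sub_nonneg.2 hs.2))
      have hzw' := (smul_eq_zero.1 hzw).resolve_left hpos.ne'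
      exact hyp (by simp [hzw'])
    exact hz (h1 w ((convex_segment p z).segment_subset hy (right_mem_segment ℝ p z) hw) hwp hwb)
  have hpre : IsPreconnected (segment ℝ y z) := (convex_segment y z).isPreconnected
  have hzc := hpre.subset_connectedComponentIn (left_mem_segment ℝ y z) hsub
    (right_mem_segment ℝ y z)
  rwa [connectedComponentIn_eq hzc]

theorem hasLogOn_region (P : SimplePolygon) (f : Plane → ℂ) (hf : ContinuousOn f P.region)
    (hf0 : ∀ z ∈ P.region, f z ≠ 0) : HasLogOn f P.region := by
  let e : ℂ ≃ₗᵢ[ℝ] Plane := Complex.orthonormalBasisOneI.repr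
  have hK : IsCompact (e.symm '' P.region) := P.isCompact_region.image e.symm.continuous
  have hlog : LogSet (e.symm '' P.region) := by
    intro a ha
    have hea : e a ∉ P.region := fun h => ha ⟨e a, h, e.symm_apply_apply a⟩
    have heab : e a ∈ P.boundaryᶜ := fun h => hea (Or.inl h)
    refine hasLogOn_sub_of_unbounded (O := e.symm '' connectedComponentIn P.boundaryᶜ (e a)) hK
      (isPreconnected_connectedComponentIn.image _ e.symm.continuous.continuousOn) ?_ ?_
      ⟨e a, mem_connectedComponentIn heab, e.symm_apply_apply a⟩
    · intro h
      refine hea (Or.inr ⟨heab, ?_⟩)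
      have := e.lipschitz.isBounded_image h
      simpa only [image_image, e.apply_symm_apply, image_id'] using this
    · rw [disjoint_image_iff e.symm.injective, disjoint_left]
      intro x hx hxO
      rcases hx with hx | ⟨_, hx⟩
      · exact connectedComponentIn_subset _ _ hxO hx
      · rw [← connectedComponentIn_eq hxO] at hx
        exact hea (Or.inr ⟨heab, hx⟩)
  obtain ⟨l, hl, hle⟩ := hlog.hasLogOn hK (f := fun z => f (e z))
    (hf.comp e.continuous.continuousOn (by
      rintro _ ⟨x, hx, rfl⟩
      rwa [e.apply_symm_apply]))
    (by
      rintro _ ⟨x, hx, rfl⟩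
      rw [e.apply_symm_apply]
      exact hf0 x hx)
  refine ⟨fun z => l (e.symm z), hl.comp e.symm.continuous.continuousOn
    (mapsTo_image _ _), fun z hz => ?_⟩
  simp only [hle _ (mem_image_of_mem _ hz), e.apply_symm_apply]

lemma isClosed_vis (P : SimplePolygon) (p : Plane) : IsClosed (P.Vis p) := by
  have h : P.Vis p = ⋂ t ∈ Icc (0 : ℝ) 1, {q | p + t • (q - p) ∈ P.region} := by
    ext q
    simp only [Vis, mem_ofPred_eq, mem_iInter, segment_eq_image']
    constructor
    · rintro ⟨_, h⟩ t ht
      exact h ⟨t, ht, rfl⟩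
    · intro h
      refine ⟨by simpa using h 1 ⟨zero_le_one, le_rfl⟩, ?_⟩
      rintro _ ⟨t, ht, rfl⟩
      exact h t ht
  rw [h]
  exact isClosed_biInter fun t _ => P.isClosed_region.preimage (by fun_prop)

lemma self_mem_vis (P : SimplePolygon) {p : Plane} (hp : p ∈ P.region) : p ∈ P.Vis p := by
  refine ⟨hp, ?_⟩
  rw [segment_same]
  exact singleton_subset_iff.2 hp

lemma isPreconnected_vis (P : SimplePolygon) {p : Plane} (hp : p ∈ P.region) :
    IsPreconnected (P.Vis p) := by
  have hs : StarConvex ℝ p (P.Vis p) := by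
    rw [starConvex_iff_segment_subset]
    intro q hq y hy
    refine ⟨hq.2 hy, ?_⟩
    exact ((convex_segment p q).segment_subset (left_mem_segment ℝ p q) hy).trans hq.2
  exact (hs.isPathConnected (P.self_mem_vis hp)).isConnected.isPreconnected

/-- A neighbor witness path crosses a component of the non-visible region attached to both
visibility regions. -/
lemma GConAdj.exists_attached {P : SimplePolygon} {W : Set Plane} (hW : P.IsWitnessSet W)
    {u v : Plane} (h : P.GConAdj W u v) :
    ∃ N, IsCompOf N (P.NVis W) ∧ P.Attached N u ∧ P.Attached N v := by
  obtain ⟨hu, hv, huv, γ, f, rfl, hf⟩ := h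
  have hcu : IsClosed {t | f t ∈ P.Vis u} := (P.isClosed_vis u).preimage f.continuous
  obtain ⟨a, ha, hamax⟩ := hcu.isCompact.exists_isMaxOn
    ⟨0, by simpa using P.self_mem_vis (hW.2.1 hu)⟩ continuousOn_id
  have hcv : IsClosed {t | f t ∈ P.Vis v ∧ a ≤ t} :=
    ((P.isClosed_vis v).preimage f.continuous).inter isClosed_Ici
  obtain ⟨b, ⟨hb, hab⟩, hbmin⟩ := hcv.isCompact.exists_isMinOn
    ⟨1, by simpa using P.self_mem_vis (hW.2.1 hv), unitInterval.le_one a⟩ continuousOn_id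
  have hdis := hW.2.2 u hu v hv huv
  have hlt : a < b := by
    refine lt_of_le_of_ne hab ?_
    rintro rfl
    have : f a ∈ P.Vis u ∩ P.Vis v := ⟨ha, hb⟩
    rw [hdis] at this
    exact this
  have hsub : f '' Ioo a b ⊆ P.NVis W := by
    rintro _ ⟨t, ⟨hat, htb⟩, rfl⟩
    rcases hf ⟨t, rfl⟩ with (h | h) | h
    · exact absurd (hamax h) (not_le.2 hat)
    · exact h
    · exact absurd (hbmin (show t ∈ {t | f t ∈ P.Vis v ∧ a ≤ t} from ⟨h, hat.le⟩)) (not_le.2 htb)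
  obtain ⟨c, hc⟩ := exists_between hlt
  have hNsub := (isPreconnected_Ioo.image f f.continuous.continuousOn).subset_connectedComponentIn
    (mem_image_of_mem f hc) hsub
  have hcl : f '' Icc a b ⊆ closure (connectedComponentIn (P.NVis W) (f c)) := by
    rw [← closure_Ioo hlt.ne]
    exact (image_closure_subset_closure_image f.continuous).trans (closure_mono hNsub)
  exact ⟨_, ⟨f c, hsub (mem_image_of_mem f hc), rfl⟩,
    ⟨f a, hcl (mem_image_of_mem f (left_mem_Icc.2 hlt.le)), ha⟩,
    ⟨f b, hcl (mem_image_of_mem f (right_mem_Icc.2 hlt.le)), hb⟩⟩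

end SimplePolygon

namespace SimplePolygon

lemma IsWitnessSet.disjoint_vis {P : SimplePolygon} {W : Set Plane} (hW : P.IsWitnessSet W)
    {u v : Plane} (hu : u ∈ W) (hv : v ∈ W) (huv : u ≠ v) : Disjoint (P.Vis u) (P.Vis v) :=
  disjoint_iff_inter_eq_empty.2 (hW.2.2 u hu v hv huv)

/-- Distinct components of the non-visible region are separated by a single visibility region. -/
lemma IsWitnessSet.eq_of_forall_linked {P : SimplePolygon} {W : Set Plane}
    (hW : P.IsWitnessSet W) (hne : W.Nonempty) {N N' : Set Plane} (hN : IsCompOf N (P.NVis W))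
    (hN' : IsCompOf N' (P.NVis W))
    (h : ∀ u ∈ W, ∃ x ∈ N, ∃ y ∈ N', Linked (P.region \ P.Vis u) x y) : N = N' := by
  obtain ⟨a, ha, rfl⟩ := hN
  obtain ⟨b, hb, rfl⟩ := hN'
  have hNu : ∀ u ∈ W, P.NVis W ⊆ P.region \ P.Vis u := fun u hu x hx =>
    ⟨hx.1, fun hxu => hx.2 (mem_biUnion hu hxu)⟩
  have hlink : ∀ u ∈ W, Linked (P.region \ P.Vis u) a b := by
    intro u hu
    obtain ⟨x, hx, y, hy, hxy⟩ := h u hu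
    have h1 : Linked (P.NVis W) a x := ⟨_, connectedComponentIn_subset _ _,
      isPreconnected_connectedComponentIn, mem_connectedComponentIn ha, hx⟩
    have h2 : Linked (P.NVis W) y b := ⟨_, connectedComponentIn_subset _ _,
      isPreconnected_connectedComponentIn, hy, mem_connectedComponentIn hb⟩
    exact ((h1.mono (hNu u hu)).trans hxy).trans (h2.mono (hNu u hu))
  obtain ⟨u, hu⟩ := hne
  obtain ⟨T, hT, hTc, haT, hbT⟩ := P.locallyStar_region.linked_diff_biUnion P.hasLogOn_region hW.1
    (fun u _ => P.isClosed_vis u) (fun u hu v hv huv => hW.disjoint_vis hu hv huv)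
    ((hlink u hu).mono sdiff_subset) hlink
  exact connectedComponentIn_eq (hTc.subset_connectedComponentIn haT hT hbT)

/-- Two components attached to the same visibility region are linked away from any other one. -/
lemma IsWitnessSet.linked_of_attached {P : SimplePolygon} {W : Set Plane}
    (hW : P.IsWitnessSet W) {N N' : Set Plane} (hN : IsCompOf N (P.NVis W))
    (hN' : IsCompOf N' (P.NVis W)) {u v : Plane} (hu : u ∈ W) (hv : v ∈ W) (huv : u ≠ v)
    (hNv : P.Attached N v) (hNv' : P.Attached N' v) {x y : Plane} (hx : x ∈ N) (hy : y ∈ N') :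
    Linked (P.region \ P.Vis u) x y := by
  have hvis : P.Vis v ⊆ P.region \ P.Vis u := fun z hz =>
    ⟨hz.1, fun hzu => (hW.disjoint_vis hu hv huv).le_bot ⟨hzu, hz⟩⟩
  have key : ∀ M : Set Plane, IsCompOf M (P.NVis W) → P.Attached M v → ∀ z ∈ M,
      Linked (P.region \ P.Vis u) z v := by
    rintro _ ⟨c, _, rfl⟩ ⟨d, hd, hdv⟩ z hz
    have h1 : Linked (P.region \ P.Vis u) z d := by
      refine ⟨insert d (connectedComponentIn (P.NVis W) c), ?_, ?_, mem_insert_of_mem _ hz,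
        mem_insert _ _⟩
      · refine insert_subset (hvis hdv) ((connectedComponentIn_subset _ _).trans ?_)
        exact fun q hq => ⟨hq.1, fun hqu => hq.2 (mem_biUnion hu hqu)⟩
      · exact isPreconnected_connectedComponentIn.subset_closure (subset_insert _ _)
          (insert_subset hd subset_closure)
    exact h1.trans ⟨P.Vis v, hvis, P.isPreconnected_vis (hW.2.1 hv), hdv,
      P.self_mem_vis (hW.2.1 hv)⟩
  exact (key N hN hNv x hx).trans (key N' hN' hNv' y hy).symm

lemma _root_.IsCompOf.nonempty {N S : Set Plane} (h : IsCompOf N S) : N.Nonempty := by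
  obtain ⟨x, hx, rfl⟩ := h
  exact ⟨x, mem_connectedComponentIn hx⟩

/-- Components attached to two common visibility regions coincide. -/
lemma IsWitnessSet.eq_of_attached_of_attached {P : SimplePolygon} {W : Set Plane}
    (hW : P.IsWitnessSet W) {N N' : Set Plane} (hN : IsCompOf N (P.NVis W))
    (hN' : IsCompOf N' (P.NVis W)) {v v' : Plane} (hv : v ∈ W) (hv' : v' ∈ W) (hne : v ≠ v')
    (h₁ : P.Attached N v) (h₂ : P.Attached N v') (h₁' : P.Attached N' v)
    (h₂' : P.Attached N' v') : N = N' := by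
  refine hW.eq_of_forall_linked ⟨v, hv⟩ hN hN' fun u hu => ?_
  obtain ⟨x, hx⟩ := hN.nonempty
  obtain ⟨y, hy⟩ := hN'.nonempty
  refine ⟨x, hx, y, hy, ?_⟩
  by_cases huv : u = v
  · exact hW.linked_of_attached hN hN' hu hv' (huv ▸ hne) h₂ h₂' hx hy
  · exact hW.linked_of_attached hN hN' hu hv huv h₁ h₁' hx hy

/-- Along a cyclic sequence of witnesses, consecutive attached components coincide. -/
lemma IsWitnessSet.eq_succ_of_cycle {P : SimplePolygon} {W : Set Plane} (hW : P.IsWitnessSet W)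
    {m : ℕ} {v : ℕ → Plane} {N : ℕ → Set Plane} (hv : ∀ k, v k ∈ W)
    (hinj : ∀ k j, 0 < j → j < m → v (k + j) ≠ v k) (hNper : ∀ k, N (k + m) = N k)
    (hm : 0 < m) (hN : ∀ k, IsCompOf (N k) (P.NVis W)) (h₁ : ∀ k, P.Attached (N k) (v k))
    (h₂ : ∀ k, P.Attached (N k) (v (k + 1))) (i : ℕ) : N i = N (i + 1) := by
  refine hW.eq_of_forall_linked ⟨v 0, hv 0⟩ (hN i) (hN (i + 1)) fun u hu => ?_
  choose x hx using fun k => (hN k).nonempty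
  by_cases huv : u = v (i + 1)
  · subst huv
    have chain : ∀ j, j + 1 ≤ m →
        Linked (P.region \ P.Vis (v (i + 1))) (x (i + 1 + j)) (x (i + 1)) := by
      intro j
      induction j with
      | zero =>
        intro _
        obtain ⟨a, ha, he⟩ := hN (i + 1)
        have hxi : x (i + 1) ∈ P.NVis W :=
          (he ▸ connectedComponentIn_subset _ _ : N (i + 1) ⊆ P.NVis W) (hx _)
        exact ⟨{x (i + 1)}, singleton_subset_iff.2
          ⟨hxi.1, fun h => hxi.2 (mem_biUnion hu h)⟩, isPreconnected_singleton, rfl, rfl⟩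
      | succ j ih =>
        intro hj
        refine Linked.trans ?_ (ih (by omega))
        exact hW.linked_of_attached (hN _) (hN _) hu (hv (i + 1 + (j + 1)))
          (hinj _ _ (by omega) (by omega)).symm (h₁ _) (h₂ _) (hx _) (hx _)
    refine ⟨x (i + m), hNper i ▸ hx (i + m), x (i + 1), hx _, ?_⟩
    have h := chain (m - 1) (by omega)
    rwa [show i + 1 + (m - 1) = i + m by omega] at h
  · exact ⟨x i, hx i, x (i + 1), hx _, hW.linked_of_attached (hN _) (hN _) hu (hv (i + 1)) huv
      (h₂ _) (h₁ _) (hx _) (hx _)⟩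

end SimplePolygon

/-- Unique component attached to all visibility regions along a cycle of
`GCon(W)`. -/
theorem unique_component_for_cycle (P : SimplePolygon) (W : Set Plane)
    (hW : P.IsWitnessSet W) (hreg : ∀ u ∈ W, P.VisRegular u)
    (m : ℕ) (hm : 3 ≤ m) (w : ℕ → Plane)
    (hmem : ∀ i < m, w i ∈ W)
    (hinj : ∀ i < m, ∀ j < m, w i = w j → i = j)
    (hadj : ∀ i < m, P.GConAdj W (w i) (w ((i + 1) % m))) :
    ∃! NV : Set Plane, IsCompOf NV (P.NVis W) ∧ ∀ i < m, P.Attached NV (w i) := by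
  have hm0 : 0 < m := by omega
  have hlt : ∀ k, k % m < m := fun k => Nat.mod_lt k hm0
  choose! N hN h₁ h₂ using fun i hi => (hadj i hi).exists_attached hW
  have hconst : ∀ k, N (k % m) = N 0 := by
    intro k
    induction k with
    | zero => rw [Nat.zero_mod]
    | succ k ih =>
      rw [← ih]
      refine (hW.eq_succ_of_cycle (m := m) (v := fun k => w (k % m)) (N := fun k => N (k % m))
        (fun k => hmem _ (hlt k)) ?_ (fun k => by simp) hm0 (fun k => hN _ (hlt k))
        (fun k => h₁ _ (hlt k)) (fun k => ?_) k).symm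
      · intro k j hj0 hjm h
        have h' : (k + j) ≡ (k + 0) [MOD m] := hinj _ (hlt _) _ (hlt _) h
        have h'' := Nat.ModEq.add_left_cancel' k h'
        rw [Nat.ModEq, Nat.mod_eq_of_lt hjm, Nat.zero_mod] at h''
        omega
      · have h := h₂ _ (hlt k)
        rwa [Nat.mod_add_mod] at h
  have hall : ∀ i < m, P.Attached (N 0) (w i) := by
    intro i hi
    rw [← hconst i, Nat.mod_eq_of_lt hi]
    exact h₁ i hi
  refine ⟨N 0, ⟨hN 0 hm0, hall⟩, ?_⟩
  rintro N' ⟨hN', hall'⟩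
  have h1m : 1 < m := by omega
  exact hW.eq_of_attached_of_attached hN' (hN 0 hm0) (hmem 0 hm0) (hmem 1 h1m)
    (fun h => absurd (hinj 0 hm0 1 h1m h) zero_ne_one) (hall' 0 hm0) (hall' 1 h1m)
    (hall 0 hm0) (hall 1 h1m)
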